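/- Let ω be a real-valued Schwartz function on ℝ² and let u = K * ω be its Biot–Savart velocity. Then ∫_{ℝ²} u(x) ω(x) dx = 0 (as a vector in ℝ², i.e. both components vanish) and ∫_{ℝ²} (x · u(x)) ω(x) dx = 0. -/

import Mathlib

open MeasureTheory Filter Real
open scoped ENNReal Topology RealInnerProductSpace

noncomputable section

abbrev R2 := EuclideanSpace ℝ (Fin 2)

/-- `x^⊥ = (-x₂, x₁)`. -/
def perp (x : R2) : R2 := (WithLp.equiv 2 (Fin 2 → ℝ)).symm ![-x 1, x 0]

/-- Biot–Savart velocity `u = K * ω`. -/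
def biotSavart (ω : R2 → ℝ) (x : R2) : R2 :=
  (2 * π)⁻¹ • ∫ y : R2, (ω y / ‖x - y‖ ^ 2) • perp (x - y)

theorem continuous_perp : Continuous perp := by
  unfold perp
  refine (PiLp.continuous_toLp 2 (fun _ : Fin 2 => ℝ)).comp ?_
  refine continuous_pi fun i => ?_
  fin_cases i <;> simp <;> fun_prop

theorem norm_perp (x : R2) : ‖perp x‖ = ‖x‖ := by
  simp [perp, EuclideanSpace.norm_eq, add_comm]

theorem perp_sub_comm (x y : R2) : perp (y - x) = -perp (x - y) := by
  ext i
  fin_cases i <;> simp [perp]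

theorem inner_self_perp (x : R2) : ⟪x, perp x⟫ = 0 := by
  simp [perp, PiLp.inner_apply]
  ring

/-- The Biot–Savart integrand, weighted by the vorticity at both points. -/
def biotSavartIntegrand (ω : R2 → ℝ) (x y : R2) : R2 :=
  ω x • ((ω y / ‖x - y‖ ^ 2) • perp (x - y))

theorem biotSavartIntegrand_swap (ω : R2 → ℝ) (x y : R2) :
    biotSavartIntegrand ω y x = -biotSavartIntegrand ω x y := by
  simp only [biotSavartIntegrand, perp_sub_comm x y, norm_sub_rev y x, smul_smul, smul_neg]
  congr 2
  ring

theorem norm_biotSavartIntegrand (ω : R2 → ℝ) (x y : R2) :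
    ‖biotSavartIntegrand ω x y‖ = ‖ω x‖ * ‖ω y‖ * ‖x - y‖⁻¹ := by
  simp only [biotSavartIntegrand, norm_smul, norm_div, norm_pow, norm_norm, norm_perp]
  rcases eq_or_ne ‖x - y‖ 0 with h | h
  · simp [h]
  · field_simp

theorem inner_biotSavartIntegrand_swap (ω : R2 → ℝ) (x y : R2) :
    ⟪y, biotSavartIntegrand ω y x⟫ = -⟪x, biotSavartIntegrand ω x y⟫ := by
  have h : ⟪x - y, biotSavartIntegrand ω x y⟫ = 0 := by
    simp [biotSavartIntegrand, inner_smul_right, inner_self_perp]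
  rw [inner_sub_left] at h
  rw [biotSavartIntegrand_swap, inner_neg_right]
  linarith

theorem measurable_biotSavartIntegrand {ω : R2 → ℝ} (hω : Measurable ω) :
    Measurable fun p : R2 × R2 => biotSavartIntegrand ω p.1 p.2 := by
  have := continuous_perp.measurable
  unfold biotSavartIntegrand
  fun_prop

theorem integrable_indicator_ball_inv_norm :
    Integrable fun z : R2 => (Set.Iio (1 : ℝ)).indicator (fun r => r⁻¹) ‖z‖ := by
  rw [integrable_fun_norm_addHaar volume (f := (Set.Iio (1 : ℝ)).indicator fun r => r⁻¹)]
  have h : IntegrableOn ((Set.Iio (1 : ℝ)).indicator fun _ => (1 : ℝ)) (Set.Ioi 0) := by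
    rw [IntegrableOn, integrable_indicator_iff measurableSet_Iio, IntegrableOn,
      Measure.restrict_restrict measurableSet_Iio, Set.Iio_inter_Ioi]
    exact integrableOn_const (by simp)
  refine h.congr_fun (fun r hr => ?_) measurableSet_Ioi
  have hr' : r ≠ 0 := ne_of_gt hr
  by_cases h1 : r < 1 <;> simp [h1, hr']

theorem inv_norm_le_indicator_add_one (z : R2) :
    ‖z‖⁻¹ ≤ (Set.Iio (1 : ℝ)).indicator (fun r => r⁻¹) ‖z‖ + 1 := by
  by_cases h : ‖z‖ < 1
  · simp [h]
  · simpa [h] using inv_le_one_of_one_le₀ (not_lt.mp h)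

/-- Integrability of `f(x) g(y) / |x - y|` in the plane for `f ∈ L¹` and `g ∈ L¹ ∩ L^∞`. -/
theorem integrable_mul_mul_inv_norm_sub {f g : R2 → ℝ} (hf : Integrable f) (hg : Integrable g)
    {C : ℝ} (hC : ∀ y, ‖g y‖ ≤ C) :
    Integrable fun p : R2 × R2 => f p.1 * g p.2 * ‖p.1 - p.2‖⁻¹ := by
  have near := (hf.norm.convolution_integrand (ContinuousLinearMap.mul ℝ ℝ)
    integrable_indicator_ball_inv_norm).swap.const_mul C
  have far := hf.norm.mul_prod hg.norm
  refine (near.add far).mono' ?_ (.of_forall fun p => ?_)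
  · exact (hf.mul_prod hg).aestronglyMeasurable.mul
      (by fun_prop : Measurable fun p : R2 × R2 => ‖p.1 - p.2‖⁻¹).aestronglyMeasurable
  · have hk := inv_norm_le_indicator_add_one (p.1 - p.2)
    have h0 : 0 ≤ (Set.Iio (1 : ℝ)).indicator (fun r => r⁻¹) ‖p.1 - p.2‖ :=
      Set.indicator_apply_nonneg fun _ => by positivity
    simp only [Pi.add_apply, Function.comp_apply, Prod.fst_swap, Prod.snd_swap,
      ContinuousLinearMap.mul_apply', norm_mul, norm_inv, norm_norm, norm_sub_rev p.2 p.1]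
    calc ‖f p.1‖ * ‖g p.2‖ * ‖p.1 - p.2‖⁻¹
        ≤ ‖f p.1‖ * ‖g p.2‖ * ((Set.Iio (1 : ℝ)).indicator (fun r => r⁻¹) ‖p.1 - p.2‖ + 1) := by
          gcongr
      _ = ‖g p.2‖ * (‖f p.1‖ * (Set.Iio (1 : ℝ)).indicator (fun r => r⁻¹) ‖p.1 - p.2‖)
          + ‖f p.1‖ * ‖g p.2‖ := by ring
      _ ≤ _ := by
          gcongr
          exact hC p.2

theorem integral_integral_eq_zero_of_antisymm {α E : Type*} [MeasurableSpace α] {μ : Measure α}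
    [SFinite μ] [NormedAddCommGroup E] [NormedSpace ℝ E] {H : α → α → E}
    (hH : Integrable (Function.uncurry H) (μ.prod μ)) (hswap : ∀ x y, H y x = -H x y) :
    ∫ x, ∫ y, H x y ∂μ ∂μ = 0 := by
  have h := integral_integral_swap hH
  have hneg : ∫ y, ∫ x, H x y ∂μ ∂μ = -∫ x, ∫ y, H x y ∂μ ∂μ := by
    rw [← integral_neg]
    refine integral_congr_ae (.of_forall fun y => ?_)
    dsimp only
    rw [← integral_neg]
    exact integral_congr_ae (.of_forall fun x => hswap y x)
  have := IsAddTorsionFree.of_isTorsionFree ℝ E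
  exact self_eq_neg.mp (h.trans hneg)

/-- For a Schwartz vorticity `ω` with Biot–Savart velocity
`u = K * ω`, one has `∫ u ω dx = 0` (componentwise) and `∫ (x·u(x)) ω(x) dx = 0`. -/
theorem biotSavart_moment_identities (ω : SchwartzMap R2 ℝ) :
    (∫ x : R2, ω x • biotSavart (⇑ω) x) = (0 : R2) ∧
    (∫ x : R2, ⟪x, biotSavart (⇑ω) x⟫ * ω x) = 0 := by
  obtain ⟨C, hC⟩ : ∃ C, ∀ y, ‖‖ω y‖‖ ≤ C := by
    obtain ⟨C, -, hC⟩ := ω.decay 0 0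
    exact ⟨C, fun y => by simpa using hC y⟩
  have hmeas := measurable_biotSavartIntegrand ω.continuous.measurable
  have hint : Integrable fun p : R2 × R2 => biotSavartIntegrand ω p.1 p.2 :=
    (integrable_mul_mul_inv_norm_sub ω.integrable.norm ω.integrable.norm hC).mono'
      hmeas.aestronglyMeasurable (.of_forall fun p => (norm_biotSavartIntegrand ω p.1 p.2).le)
  have hintInner : Integrable fun p : R2 × R2 => ⟪p.1, biotSavartIntegrand ω p.1 p.2⟫ := by
    have hf : Integrable fun x : R2 => ‖x‖ * ‖ω x‖ := by
      simpa using ω.integrable_pow_mul volume 1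
    refine (integrable_mul_mul_inv_norm_sub hf ω.integrable.norm hC).mono'
      (measurable_fst.inner hmeas).aestronglyMeasurable (.of_forall fun p => ?_)
    refine (norm_inner_le_norm _ _).trans_eq ?_
    rw [norm_biotSavartIntegrand]
    ring
  have hvel (x : R2) :
      ω x • biotSavart ω x = (2 * π)⁻¹ • ∫ y, biotSavartIntegrand ω x y := by
    simp only [biotSavart, biotSavartIntegrand]
    rw [smul_comm, integral_smul]
  constructor
  · simp only [hvel]
    rw [integral_smul, integral_integral_eq_zero_of_antisymm hint (biotSavartIntegrand_swap ω),
      smul_zero]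
  · have hae : ∀ᵐ x : R2, ⟪x, biotSavart ω x⟫ * ω x =
        (2 * π)⁻¹ * ∫ y, ⟪x, biotSavartIntegrand ω x y⟫ := by
      filter_upwards [hint.prod_right_ae] with x hx
      rw [integral_inner hx, mul_comm, ← real_inner_smul_right, hvel, real_inner_smul_right]
    rw [integral_congr_ae hae, integral_const_mul,
      integral_integral_eq_zero_of_antisymm hintInner (inner_biotSavartIntegrand_swap ω), mul_zero]

end
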